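/- Let (Ω,𝒜,T,μ,ℱ,‖·‖,χ) fulfill Property 𝔇 with μ(χ>x)=L(x)/x^α for all x>0, L slowly varying, 0<α<1; let (b_n) be natural numbers tending to infinity with b_n=o(n); put ζ_n := b_n^{2/3}, g_n := F^←(1−(b_n−ζ_n)/n); assume ψ(r)<1 where r := min{n∈ℕ : ψ(n)<1}. Define Φ'_{1,n} := { #{ j≤n : χ∘T^{j-1} > g_n } > b_n − 2r + 1 }. Then (∫ T_n^{2·g_n}χ dμ) · μ(Φ'_{1,n}) = o( ∫ T_n^{g_n}χ dμ ) as n→∞. -/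

import Mathlib

open MeasureTheory Filter Topology ENNReal

noncomputable section

/-- Birkhoff sum `S_n χ = ∑_{k=1}^n χ ∘ T^{k-1}`. -/
def birkhoffSumN {Ω : Type*} (T : Ω → Ω) (χ : Ω → ℝ) (n : ℕ) (ω : Ω) : ℝ :=
  ∑ k ∈ Finset.range n, χ (T^[k] ω)

/-- Trimmed sum `S_n^b χ`: the sum of the `n - b` smallest values among
`χ(ω), χ(Tω), …, χ(T^{n-1}ω)`. -/
def trimmedSumN {Ω : Type*} (T : Ω → Ω) (χ : Ω → ℝ) (n b : ℕ) (ω : Ω) : ℝ :=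
  (((((List.range n).map fun k => χ (T^[k] ω))).mergeSort (fun a b => a ≤ b)).take (n - b)).sum

/-- Truncated sum `T_n^f χ = ∑_{k=1}^n (χ·1_{χ ≤ f}) ∘ T^{k-1}`. -/
def truncSumN {Ω : Type*} (T : Ω → Ω) (χ : Ω → ℝ) (n : ℕ) (f : ℝ) (ω : Ω) : ℝ :=
  ∑ k ∈ Finset.range n, if χ (T^[k] ω) ≤ f then χ (T^[k] ω) else 0

/-- A function `L` is slowly varying if `L(cx)/L(x) → 1` as `x → ∞`, for every `c > 0`. -/
def SlowlyVarying (L : ℝ → ℝ) : Prop :=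
  ∀ c : ℝ, 0 < c → Tendsto (fun x => L (c * x) / L x) atTop (𝓝 1)

/-- `ls` is a de Bruijn conjugate of the slowly varying function `Lt`. -/
def IsDeBruijnConjugate (Lt ls : ℝ → ℝ) : Prop :=
  SlowlyVarying ls ∧
  Tendsto (fun x => Lt x * ls (x * Lt x)) atTop (𝓝 1) ∧
  Tendsto (fun x => ls x * Lt (x * ls x)) atTop (𝓝 1)

/-- The measure of dependence `ψ(ℬ,𝒞)` between two sub-σ-fields. -/
def psiDep {Ω : Type*} [MeasurableSpace Ω] (μ : Measure Ω)
    (B C : MeasurableSpace Ω) : ℝ≥0∞ :=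
  ⨆ (b : Set Ω) (c : Set Ω) (_ : MeasurableSet[B] b) (_ : MeasurableSet[C] c)
    (_ : 0 < μ b) (_ : 0 < μ c),
    ENNReal.ofReal |(μ (b ∩ c)).toReal / ((μ b).toReal * (μ c).toReal) - 1|

/-- The σ-field generated by `X_k = χ ∘ T^{k-1}` for `J ≤ k ≤ L`. -/
def sigmaIcc {Ω : Type*} [MeasurableSpace Ω] (T : Ω → Ω) (χ : Ω → ℝ) (J L : ℕ) :
    MeasurableSpace Ω :=
  ⨆ k ∈ Set.Icc J L, MeasurableSpace.comap (fun ω => χ (T^[k - 1] ω)) inferInstance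

/-- The σ-field generated by `X_k = χ ∘ T^{k-1}` for `k ≥ J`. -/
def sigmaIci {Ω : Type*} [MeasurableSpace Ω] (T : Ω → Ω) (χ : Ω → ℝ) (J : ℕ) :
    MeasurableSpace Ω :=
  ⨆ k ∈ Set.Ici J, MeasurableSpace.comap (fun ω => χ (T^[k - 1] ω)) inferInstance

/-- The `n`-th ψ-mixing coefficient of the sequence `(χ ∘ T^{k-1})_{k ≥ 1}`. -/
def psiCoeff {Ω : Type*} [MeasurableSpace Ω] (μ : Measure Ω) (T : Ω → Ω) (χ : Ω → ℝ)
    (n : ℕ) : ℝ≥0∞ :=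
  ⨆ (k : ℕ) (_ : 1 ≤ k), psiDep μ (sigmaIcc T χ 1 k) (sigmaIci T χ (k + n))

/-- A bounded operator `U` has a spectral gap: `U = λ·P + N` with `P` a one-dimensional
projection, `ρ(N) < |λ|`, and `PN = NP = 0`. -/
def HasSpectralGap {F : Type*} [NormedAddCommGroup F] [NormedSpace ℝ F] [CompleteSpace F]
    (U : F →L[ℝ] F) : Prop :=
  ∃ (lam : ℝ) (P N : F →L[ℝ] F),
    U = lam • P + N ∧ P.comp P = P ∧
    Module.finrank ℝ (LinearMap.range (P : F →ₗ[ℝ] F)) = 1 ∧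
    spectralRadius ℝ N < ENNReal.ofReal |lam| ∧
    P.comp N = 0 ∧ N.comp P = 0

/-- Property ℭ: `μ` is a `T`-invariant mixing probability measure, `ℱ` (realized as a Banach
algebra `F` of measurable functions via the injective algebra homomorphism `ι`) contains the
constants, dominates the sup norm, and the transfer operator restricts to a bounded operator
on `F` with a spectral gap. -/
structure PropertyC {Ω : Type*} [MeasurableSpace Ω] (T : Ω → Ω) (μ : Measure Ω)
    {F : Type*} [NormedRing F] [NormedAlgebra ℝ F] [CompleteSpace F]
    (ι : F →ₐ[ℝ] Ω → ℝ) : Prop where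
  prob : IsProbabilityMeasure μ
  invariant : MeasurePreserving T μ μ
  mixing : ∀ A B : Set Ω, MeasurableSet A → MeasurableSet B →
    Tendsto (fun n => μ (A ∩ T^[n] ⁻¹' B)) atTop (𝓝 (μ A * μ B))
  inj : Function.Injective ι
  measurable_mem : ∀ f : F, Measurable (ι f)
  norm_ge_sup : ∀ (f : F) (ω : Ω), |ι f ω| ≤ ‖f‖
  transfer : ∃ That : F →L[ℝ] F,
    (∀ (f : F) (g : Ω → ℝ), Measurable g → (∃ C, ∀ ω, |g ω| ≤ C) →
      ∫ ω, ι (That f) ω * g ω ∂μ = ∫ ω, ι f ω * g (T ω) ∂μ) ∧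
    HasSpectralGap That

/-- Property 𝔇: Property ℭ together with the norm control on truncations of the
nonnegative observable `χ`. -/
structure PropertyD {Ω : Type*} [MeasurableSpace Ω] (T : Ω → Ω) (μ : Measure Ω)
    {F : Type*} [NormedRing F] [NormedAlgebra ℝ F] [CompleteSpace F]
    (ι : F →ₐ[ℝ] Ω → ℝ) (χ : Ω → ℝ) extends PropertyC T μ ι : Prop where
  chi_nonneg : ∀ ω, 0 ≤ χ ω
  chi_meas : Measurable χ
  norm_bound : ∃ K₁ > (0 : ℝ), ∀ ℓ : ℝ, 0 ≤ ℓ →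
    (∃ f : F, ι f = (fun ω => if χ ω ≤ ℓ then χ ω else 0) ∧ ‖f‖ ≤ K₁ * ℓ) ∧
    (∃ g : F, ι g = (fun ω => if ℓ < χ ω then (1 : ℝ) else 0) ∧ ‖g‖ ≤ K₁)

/-- The distribution function `F(x) = μ(χ ≤ x)`. -/
def distF {Ω : Type*} [MeasurableSpace Ω] (μ : Measure Ω) (χ : Ω → ℝ) (x : ℝ) : ℝ :=
  (μ {ω | χ ω ≤ x}).toReal

/-- Generalized inverse `F^←(y) = inf {x | F(x) ≥ y}`. -/
def genInv (F : ℝ → ℝ) (y : ℝ) : ℝ := sInf {x : ℝ | y ≤ F x}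

/-- `g_n = F^←(1 - (b_n - ζ_n)/n)` where `ζ_n = b_n^{2/3}`. -/
def gSeq {Ω : Type*} [MeasurableSpace Ω] (μ : Measure Ω) (χ : Ω → ℝ) (b : ℕ → ℕ)
    (n : ℕ) : ℝ :=
  genInv (distF μ χ) (1 - ((b n : ℝ) - (b n : ℝ) ^ ((2 : ℝ) / 3)) / n)

/-- The norming sequence `d_n = (α/(1-α))·n^{1/α}·b_n^{1-1/α}·ℓ^#((n/b_n)^{1/α})`. -/
def dSeq (α : ℝ) (ls : ℝ → ℝ) (b : ℕ → ℕ) (n : ℕ) : ℝ :=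
  α / (1 - α) * (n : ℝ) ^ (1 / α) * (b n : ℝ) ^ (1 - 1 / α) *
    ls (((n : ℝ) / (b n : ℝ)) ^ (1 / α))

end


section Helpers

variable {Ω : Type*} [m0 : MeasurableSpace Ω] {T : Ω → Ω} {χ : Ω → ℝ} {μ : Measure Ω}

lemma sigmaIcc_le' (hT : Measurable T) (hχ : Measurable χ) (J L : ℕ) :
    sigmaIcc T χ J L ≤ m0 := by
  refine iSup₂_le fun k _ => ?_
  exact (hχ.comp (hT.iterate _)).comap_le

lemma sigmaIcc_mono' {J L J' L' : ℕ} (h1 : J' ≤ J) (h2 : L ≤ L') :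
    sigmaIcc T χ J L ≤ sigmaIcc T χ J' L' := by
  refine iSup₂_le fun k hk => ?_
  exact le_iSup₂_of_le k (⟨h1.trans hk.1, hk.2.trans h2⟩ : k ∈ Set.Icc J' L') le_rfl

lemma sigmaIcc_le_Ici' {J L : ℕ} :
    sigmaIcc T χ J L ≤ sigmaIci T χ J := by
  refine iSup₂_le fun k hk => ?_
  exact le_iSup₂_of_le k (hk.1 : k ∈ Set.Ici J) le_rfl

lemma sigmaIcc_shift {J L : ℕ} (hJ : 1 ≤ J) (s : ℕ) {A : Set Ω}
    (hA : MeasurableSet[sigmaIcc T χ J L] A) :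
    MeasurableSet[sigmaIcc T χ (J + s) (L + s)] (T^[s] ⁻¹' A) := by
  have : sigmaIcc T χ J L ≤ (sigmaIcc T χ (J + s) (L + s)).map (T^[s]) := by
    refine iSup₂_le fun k hk => ?_
    rintro B ⟨U, hU, rfl⟩
    have hk1 : 1 ≤ k := hJ.trans hk.1
    have h2 : MeasurableSpace.comap (fun ω => χ (T^[k + s - 1] ω)) inferInstance
        ≤ sigmaIcc T χ (J + s) (L + s) :=
      le_iSup₂_of_le (k + s) (⟨by have := hk.1; omega, by have := hk.2; omega⟩ :
        k + s ∈ Set.Icc (J + s) (L + s)) le_rfl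
    refine h2 _ ⟨U, hU, ?_⟩
    ext ω
    simp only [Set.mem_preimage]
    rw [← Function.iterate_add_apply]
    have : k + s - 1 = k - 1 + s := by omega
    rw [this]
  exact this A hA

lemma measurable_X {J L k : ℕ} (h : k ∈ Set.Icc J L) :
    Measurable[sigmaIcc T χ J L] (fun ω => χ (T^[k - 1] ω)) := by
  rw [measurable_iff_comap_le]
  exact le_iSup₂_of_le k h le_rfl

/-- Upper psi-mixing bound at gap `n`, for events in finite windows. -/
def Bd (μ : Measure Ω) (T : Ω → Ω) (χ : Ω → ℝ) (n : ℕ) (K : ℝ) : Prop :=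
  ∀ (k l : ℕ) (A B : Set Ω), 1 ≤ k → MeasurableSet[sigmaIcc T χ 1 k] A →
    MeasurableSet[sigmaIcc T χ (k + n) l] B → μ.real (A ∩ B) ≤ K * μ.real A * μ.real B

lemma Bd.mono {n n' : ℕ} {K K' : ℝ} (h : Bd μ T χ n K) (hn : n ≤ n') (hK : K ≤ K') :
    Bd μ T χ n' K' := by
  intro k l A B hk hA hB
  refine (h k l A B hk hA (sigmaIcc_mono' (by omega) le_rfl _ hB)).trans ?_
  gcongr

lemma Bd_of_psi [IsProbabilityMeasure μ] {r : ℕ} (h : psiCoeff μ T χ r < 1) :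
    Bd μ T χ r 2 := by
  intro k l A B hk hA hB
  by_cases hA0 : μ A = 0
  · have : μ (A ∩ B) = 0 := measure_mono_null Set.inter_subset_left hA0
    simp [Measure.real, this, hA0]
  by_cases hB0 : μ B = 0
  · have : μ (A ∩ B) = 0 := measure_mono_null Set.inter_subset_right hB0
    simp [Measure.real, this, hB0]
  have hA1 : 0 < μ A := pos_iff_ne_zero.2 hA0
  have hB1 : 0 < μ B := pos_iff_ne_zero.2 hB0
  have hB' := sigmaIcc_le_Ici' _ hB
  have h1 : ENNReal.ofReal |(μ (A ∩ B)).toReal / ((μ A).toReal * (μ B).toReal) - 1|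
      ≤ psiCoeff μ T χ r := by
    refine le_trans ?_ (le_iSup₂ (f := fun (k : ℕ) (_ : 1 ≤ k) =>
      psiDep μ (sigmaIcc T χ 1 k) (sigmaIci T χ (k + r))) k hk)
    unfold psiDep
    refine le_iSup_of_le A (le_iSup_of_le B (le_iSup_of_le hA (le_iSup_of_le hB'
      (le_iSup_of_le hA1 (le_iSup_of_le hB1 le_rfl)))))
  have h2 := h1.trans_lt h
  rw [ENNReal.ofReal_lt_one, abs_lt] at h2
  have pA : 0 < (μ A).toReal := ENNReal.toReal_pos hA0 (measure_ne_top _ _)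
  have pB : 0 < (μ B).toReal := ENNReal.toReal_pos hB0 (measure_ne_top _ _)
  have h3 : (μ (A ∩ B)).toReal / ((μ A).toReal * (μ B).toReal) ≤ 2 := by linarith [h2.2]
  rw [div_le_iff₀ (by positivity)] at h3
  simp only [Measure.real]
  linarith

/-- domination of integrals on a sub sigma-field -/
lemma setLIntegral_dom [IsProbabilityMeasure μ] {m : MeasurableSpace Ω} (hm : m ≤ m0)
    {C : Set Ω} {K : ℝ} (hK : 0 ≤ K)
    (h : ∀ E, MeasurableSet[m] E → μ.real (E ∩ C) ≤ K * μ.real E * μ.real C)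
    {f : Ω → ℝ≥0∞} (hf : Measurable[m] f) :
    ∫⁻ ω in C, f ω ∂μ ≤ ENNReal.ofReal (K * μ.real C) * ∫⁻ ω, f ω ∂μ := by
  rw [← lintegral_trim hm hf, ← lintegral_trim (μ := μ) hm hf]
  have hle : (μ.restrict C).trim hm ≤ (ENNReal.ofReal (K * μ.real C)) • μ.trim hm := by
    refine Measure.le_iff.2 fun E hE => ?_
    rw [trim_measurableSet_eq hm hE, Measure.smul_apply, trim_measurableSet_eq hm hE,
      Measure.restrict_apply (hm _ hE), smul_eq_mul]
    have := h E hE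
    rw [← ofReal_measureReal, ← ofReal_measureReal (s := E), ← ENNReal.ofReal_mul (by positivity)]
    apply ENNReal.ofReal_le_ofReal
    linarith
  calc _ ≤ ∫⁻ a, f a ∂((ENNReal.ofReal (K * μ.real C)) • μ.trim hm) := lintegral_mono' hle le_rfl
    _ = _ := by rw [lintegral_smul_measure, smul_eq_mul]

lemma cesaro_dist {c : ℕ → ℝ} (hc : Tendsto c atTop (𝓝 0)) (hc1 : ∀ d, |c d| ≤ 1) {η : ℝ}
    (hη : 0 < η) : ∀ᶠ J : ℕ in atTop,
      ∑ i ∈ Finset.range J, ∑ j ∈ Finset.range J, |c (Nat.dist i j)| ≤ η * (J : ℝ) ^ 2 := by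
  obtain ⟨D, hD⟩ := (Metric.tendsto_atTop.1 hc) (η / 2) (by positivity)
  filter_upwards [eventually_ge_atTop (Nat.ceil (4 * D / η)), eventually_gt_atTop 0] with J hJ hJ0
  have hJ' : 4 * D / η ≤ (J : ℝ) := (Nat.le_ceil _).trans (by exact_mod_cast hJ)
  rw [div_le_iff₀ hη] at hJ'
  have hJpos : (0 : ℝ) < J := by exact_mod_cast hJ0
  have h1 : ∀ i ∈ Finset.range J, ∑ j ∈ Finset.range J, |c (Nat.dist i j)|
      ≤ J * (η / 2) + 2 * D := by
    intro i _
    have h2 : ∀ j ∈ Finset.range J, |c (Nat.dist i j)| ≤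
        η / 2 + (if j ∈ Finset.Ico (i + 1 - D) (i + D) then (1 : ℝ) else 0) := by
      intro j _
      by_cases hd : D ≤ Nat.dist i j
      · have := hD _ hd
        rw [Real.dist_eq, sub_zero] at this
        have h0 : (0 : ℝ) ≤ (if j ∈ Finset.Ico (i + 1 - D) (i + D) then (1 : ℝ) else 0) := by
          split_ifs <;> norm_num
        linarith
      · have hmem : j ∈ Finset.Ico (i + 1 - D) (i + D) := by
          rw [Finset.mem_Ico]; simp only [Nat.dist] at hd; omega
        rw [if_pos hmem]
        have := hc1 (Nat.dist i j)
        linarith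
    refine (Finset.sum_le_sum h2).trans ?_
    rw [Finset.sum_add_distrib, Finset.sum_const, Finset.card_range, nsmul_eq_mul,
      Finset.sum_ite_mem, Finset.sum_const, nsmul_eq_mul, mul_one]
    gcongr
    have : (Finset.range J ∩ Finset.Ico (i + 1 - D) (i + D)).card ≤ 2 * D := by
      refine (Finset.card_le_card Finset.inter_subset_right).trans ?_
      rw [Nat.card_Ico]; omega
    exact_mod_cast this
  refine (Finset.sum_le_sum h1).trans ?_
  rw [Finset.sum_const, Finset.card_range, nsmul_eq_mul]
  nlinarith

lemma avg_mixing_aux [IsProbabilityMeasure μ] (hT : MeasurePreserving T μ μ)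
    (hmix : ∀ A B : Set Ω, MeasurableSet A → MeasurableSet B →
      Tendsto (fun n => μ (A ∩ T^[n] ⁻¹' B)) atTop (𝓝 (μ A * μ B)))
    {M : Set Ω} (hM : MeasurableSet M) {η : ℝ} (hη : 0 < η) :
    ∀ᶠ J : ℕ in atTop, ∀ (C : Set Ω) (s : ℕ),
      (∀ w : ℕ → ℝ, ∫⁻ ω in C, ENNReal.ofReal |∑ j ∈ Finset.range J,
          w j * ((T^[s + j] ⁻¹' M).indicator 1 ω - μ.real M)| ∂μ ≤
        ENNReal.ofReal (2 * μ.real C) * ∫⁻ ω, ENNReal.ofReal |∑ j ∈ Finset.range J,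
          w j * ((T^[s + j] ⁻¹' M).indicator 1 ω - μ.real M)| ∂μ) →
      ∑ j ∈ Finset.range J, |μ.real (T^[s + j] ⁻¹' M ∩ C) - μ.real M * μ.real C|
        ≤ η * J * μ.real C := by
  set c : ℕ → ℝ := fun d => μ.real (M ∩ T^[d] ⁻¹' M) - μ.real M ^ 2 with hcdef
  have hc : Tendsto c atTop (𝓝 0) := by
    have h1 := hmix M M hM hM
    have h2 := (ENNReal.tendsto_toReal (ENNReal.mul_ne_top (measure_ne_top μ M)
      (measure_ne_top μ M))).comp h1
    have h3 := h2.sub_const (μ.real M ^ 2)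
    rw [ENNReal.toReal_mul] at h3
    have : (μ M).toReal * (μ M).toReal - μ.real M ^ 2 = 0 := by simp only [Measure.real]; ring
    rw [this] at h3
    exact h3
  have hc1 : ∀ d, |c d| ≤ 1 := by
    intro d
    have h1 : μ.real (M ∩ T^[d] ⁻¹' M) ≤ 1 := measureReal_le_one
    have h2 : μ.real M ≤ 1 := measureReal_le_one
    have h3 : 0 ≤ μ.real (M ∩ T^[d] ⁻¹' M) := measureReal_nonneg
    have h4 : 0 ≤ μ.real M := measureReal_nonneg
    rw [abs_le]
    constructor <;> simp only [hcdef] <;> nlinarith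
  filter_upwards [cesaro_dist hc hc1 (η := (η / 2) ^ 2) (by positivity), eventually_gt_atTop 0]
    with J hJ hJ0 C s hdom
  have hJpos : (0 : ℝ) < J := by exact_mod_cast hJ0
  set a := μ.real M with ha
  set Mj : ℕ → Set Ω := fun j => T^[s + j] ⁻¹' M with hMj
  have hMjm : ∀ j, MeasurableSet (Mj j) := fun j => (hT.measurable.iterate _) hM
  have hMja : ∀ j, μ.real (Mj j) = a := fun j => by
    simp only [Measure.real, hMj, ha]
    rw [(hT.iterate (s + j)).measure_preimage hM.nullMeasurableSet]
  have hMij' : ∀ i j, i ≤ j → μ.real (Mj i ∩ Mj j) - a ^ 2 = c (Nat.dist i j) := by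
    intro i j hij
    have : Mj i ∩ Mj j = T^[s + i] ⁻¹' (M ∩ T^[Nat.dist i j] ⁻¹' M) := by
      ext ω
      simp only [hMj, Set.mem_inter_iff, Set.mem_preimage, ← Function.iterate_add_apply]
      have : Nat.dist i j + (s + i) = s + j := by simp only [Nat.dist]; omega
      rw [this]
    rw [this]
    simp only [hcdef, Measure.real]
    rw [(hT.iterate (s + i)).measure_preimage
      (hM.inter ((hT.measurable.iterate _) hM)).nullMeasurableSet]
  have hMij : ∀ i j, μ.real (Mj i ∩ Mj j) - a ^ 2 = c (Nat.dist i j) := by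
    intro i j
    rcases le_total i j with h | h
    · exact hMij' i j h
    · rw [Set.inter_comm, Nat.dist_comm]; exact hMij' j i h
  set e : ℕ → Ω → ℝ := fun j ω => (Mj j).indicator 1 ω - a with he
  have heb : ∀ j ω, |e j ω| ≤ 1 := by
    intro j ω
    have h2 : a ≤ 1 := measureReal_le_one
    have h4 : 0 ≤ a := measureReal_nonneg
    simp only [he]
    by_cases hω : ω ∈ Mj j
    · rw [Set.indicator_of_mem hω, Pi.one_apply, abs_le]
      constructor <;> linarith
    · rw [Set.indicator_of_notMem hω, abs_le]
      constructor <;> linarith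
  have hem0 : ∀ j, Measurable (e j) := fun j =>
    ((measurable_one (α := ℝ)).indicator (hMjm j)).sub_const a
  have heint : ∀ (ν : Measure Ω) [IsFiniteMeasure ν] j, Integrable (e j) ν := fun ν _ j =>
    Integrable.of_bound (hem0 j).aestronglyMeasurable 1 (ae_of_all _ (heb j))
  have heij : ∀ i j, Integrable (fun ω => e i ω * e j ω) μ := fun i j =>
    Integrable.of_bound ((hem0 i).mul (hem0 j)).aestronglyMeasurable 1
      (ae_of_all _ fun ω => by
        rw [Real.norm_eq_abs, abs_mul]
        exact mul_le_one₀ (heb i ω) (abs_nonneg _) (heb j ω))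
  have hIind : ∀ (ν : Measure Ω) [IsFiniteMeasure ν] (S : Set Ω), MeasurableSet S →
      Integrable (S.indicator (1 : Ω → ℝ)) ν := fun ν _ S hS =>
    (integrable_const (1 : ℝ)).indicator hS
  have hee : ∀ i j, ∫ ω, e i ω * e j ω ∂μ = c (Nat.dist i j) := by
    intro i j
    have h1 : ∀ ω, e i ω * e j ω = (Mj i ∩ Mj j).indicator 1 ω - a * (Mj i).indicator 1 ω
        - a * (Mj j).indicator 1 ω + a ^ 2 := by
      intro ω
      simp only [he, Set.inter_indicator_one, Pi.mul_apply]; ring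
    simp only [h1]
    rw [integral_add, integral_sub, integral_sub, integral_const_mul, integral_const_mul,
      integral_indicator_one (hMjm i), integral_indicator_one (hMjm j),
      integral_indicator_one ((hMjm i).inter (hMjm j)), hMja, hMja, ← hMij]
    · simp; ring
    · exact hIind μ _ ((hMjm i).inter (hMjm j))
    · exact (hIind μ _ (hMjm i)).const_mul a
    · exact (hIind μ _ ((hMjm i).inter (hMjm j))).sub ((hIind μ _ (hMjm i)).const_mul a)
    · exact (hIind μ _ (hMjm j)).const_mul a
    · exact ((hIind μ _ ((hMjm i).inter (hMjm j))).sub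
        ((hIind μ _ (hMjm i)).const_mul a)).sub ((hIind μ _ (hMjm j)).const_mul a)
    · exact integrable_const _
  set u : ℕ → ℝ := fun j => μ.real (Mj j ∩ C) - a * μ.real C with hu
  set sg : ℕ → ℝ := fun j => if 0 ≤ u j then 1 else -1 with hsg
  have hsg1 : ∀ j, |sg j| = 1 := by intro j; simp only [hsg]; split_ifs <;> simp
  have hsgu : ∀ j, sg j * u j = |u j| := by
    intro j; simp only [hsg]; split_ifs with h
    · rw [abs_of_nonneg h, one_mul]
    · rw [abs_of_neg (not_le.1 h)]; ring
  set Z : Ω → ℝ := fun ω => ∑ j ∈ Finset.range J, sg j * e j ω with hZ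
  have hZm0 : Measurable Z :=
    Finset.measurable_fun_sum _ fun j _ => (hem0 j).const_mul _
  have hZint : ∀ (ν : Measure Ω) [IsFiniteMeasure ν], Integrable Z ν := fun ν _ =>
    integrable_finset_sum _ fun j _ => (heint ν j).const_mul _
  have hZC : ∫ ω in C, Z ω ∂μ = ∑ j ∈ Finset.range J, |u j| := by
    simp only [hZ]
    rw [integral_finset_sum _ fun j _ => (heint _ j).const_mul _]
    refine Finset.sum_congr rfl fun j _ => ?_
    rw [integral_const_mul, ← hsgu]
    congr 1
    simp only [he]
    rw [integral_sub (hIind _ _ (hMjm j)) (integrable_const _), integral_indicator_one (hMjm j)]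
    simp [hu, measureReal_restrict_apply (hMjm j)]; ring
  have hZ2 : ∫ ω, Z ω ^ 2 ∂μ ≤ (η / 2) ^ 2 * (J : ℝ) ^ 2 := by
    have h1 : ∀ ω, Z ω ^ 2 = ∑ i ∈ Finset.range J, ∑ j ∈ Finset.range J,
        (sg i * sg j) * (e i ω * e j ω) := by
      intro ω
      simp only [hZ]
      rw [sq, Finset.sum_mul_sum]
      refine Finset.sum_congr rfl fun i _ => Finset.sum_congr rfl fun j _ => by ring
    simp only [h1]
    rw [integral_finset_sum _ fun i _ => integrable_finset_sum _ fun j _ => (heij i j).const_mul _]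
    refine le_trans (Finset.sum_le_sum fun i _ => ?_) hJ
    rw [integral_finset_sum _ fun j _ => (heij i j).const_mul _]
    refine Finset.sum_le_sum fun j _ => ?_
    rw [integral_const_mul, hee]
    refine (le_abs_self _).trans ?_
    rw [abs_mul, abs_mul, hsg1, hsg1]; simp
  have hZ2int : Integrable (fun ω => Z ω ^ 2) μ := by
    refine Integrable.of_bound (hZm0.pow_const 2).aestronglyMeasurable ((J : ℝ) ^ 2)
      (ae_of_all _ fun ω => ?_)
    rw [Real.norm_eq_abs, abs_pow]
    gcongr
    refine (Finset.abs_sum_le_sum_abs _ _).trans ?_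
    refine (Finset.sum_le_sum (g := fun _ => (1 : ℝ)) fun j _ => ?_).trans (by simp)
    rw [abs_mul, hsg1, one_mul]; exact heb j ω
  have habs : ∫ ω, |Z ω| ∂μ ≤ η / 2 * J := by
    have ht : 0 < η / 2 * J := by positivity
    have h1 : ∫ ω, |Z ω| ∂μ ≤ ∫ ω, (η / 2 * J / 2 + (1 / (2 * (η / 2 * J))) * Z ω ^ 2) ∂μ := by
      refine integral_mono (hZint μ).abs ((integrable_const _).add (hZ2int.const_mul _))
        fun ω => ?_
      have h3 : 0 ≤ (η / 2 * J - |Z ω|) ^ 2 / (2 * (η / 2 * J)) := by positivity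
      have h4 : (η / 2 * J - |Z ω|) ^ 2 / (2 * (η / 2 * J)) =
          η / 2 * J / 2 + (1 / (2 * (η / 2 * J))) * Z ω ^ 2 - |Z ω| := by
        rw [sub_sq, sq_abs]; field_simp; ring
      simp only
      linarith
    rw [integral_add (integrable_const _) (hZ2int.const_mul _), integral_const_mul] at h1
    have h5 : (1 / (2 * (η / 2 * J))) * ∫ ω, Z ω ^ 2 ∂μ ≤
        (1 / (2 * (η / 2 * J))) * ((η / 2) ^ 2 * (J : ℝ) ^ 2) := by gcongr
    have h6 : (1 / (2 * (η / 2 * J))) * ((η / 2) ^ 2 * (J : ℝ) ^ 2) = η / 2 * J / 2 := by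
      field_simp
    simp at h1
    simp at h5 h6
    linarith
  have hdomZ : ∫⁻ ω in C, ENNReal.ofReal |Z ω| ∂μ ≤
      ENNReal.ofReal (2 * μ.real C) * ∫⁻ ω, ENNReal.ofReal |Z ω| ∂μ := hdom sg
  rw [← ofReal_integral_eq_lintegral_ofReal (hZint _).abs (ae_of_all _ fun _ => abs_nonneg _),
    ← ofReal_integral_eq_lintegral_ofReal (hZint _).abs (ae_of_all _ fun _ => abs_nonneg _),
    ← ENNReal.ofReal_mul (by positivity), ENNReal.ofReal_le_ofReal_iff
      (mul_nonneg (by positivity) (integral_nonneg fun _ => abs_nonneg _))] at hdomZ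
  have hle : ∫ ω in C, Z ω ∂μ ≤ ∫ ω in C, |Z ω| ∂μ :=
    integral_mono (hZint _) (hZint _).abs fun ω => le_abs_self _
  rw [hZC] at hle
  refine hle.trans (hdomZ.trans ?_)
  have hC0 : 0 ≤ μ.real C := measureReal_nonneg
  calc 2 * μ.real C * ∫ ω, |Z ω| ∂μ ≤ 2 * μ.real C * (η / 2 * J) := by gcongr
    _ = _ := by ring

lemma meas_aux {Ω : Type*} [MeasurableSpace Ω] {J : ℕ} {M : ℕ → Set Ω}
    (hM : ∀ j < J, MeasurableSet (M j)) (w : ℕ → ℝ) (a : ℝ) :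
    Measurable fun ω => ENNReal.ofReal |∑ j ∈ Finset.range J,
          w j * ((M j).indicator 1 ω - a)| := by
  refine ENNReal.measurable_ofReal.comp ((measurable_abs (α := ℝ)).comp ?_)
  refine Finset.measurable_fun_sum _ fun j hj => ?_
  exact (((measurable_one (α := ℝ)).indicator
    (hM j (Finset.mem_range.1 hj))).sub_const _).const_mul _

lemma avg_mixing [IsProbabilityMeasure μ] (hT : MeasurePreserving T μ μ)
    (hmix : ∀ A B : Set Ω, MeasurableSet A → MeasurableSet B →
      Tendsto (fun n => μ (A ∩ T^[n] ⁻¹' B)) atTop (𝓝 (μ A * μ B)))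
    {M : Set Ω} (hM : MeasurableSet M) {η : ℝ} (hη : 0 < η) :
    ∀ᶠ J : ℕ in atTop, ∀ (m : MeasurableSpace Ω), m ≤ m0 → ∀ (C : Set Ω),
      (∀ E, MeasurableSet[m] E → μ.real (E ∩ C) ≤ 2 * μ.real E * μ.real C) →
      ∀ s : ℕ, (∀ j < J, MeasurableSet[m] (T^[s + j] ⁻¹' M)) →
      ∑ j ∈ Finset.range J, |μ.real (T^[s + j] ⁻¹' M ∩ C) - μ.real M * μ.real C|
        ≤ η * J * μ.real C := by
  filter_upwards [avg_mixing_aux hT hmix hM hη] with J hJ m hm C hdom s hmeas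
  refine hJ C s fun w => ?_
  exact setLIntegral_dom (m0 := m0) (m := m) hm (by norm_num : (0 : ℝ) ≤ 2) hdom
    (@meas_aux Ω m J (fun j => T^[s + j] ⁻¹' M) hmeas w (μ.real M))

lemma bradley_step [IsProbabilityMeasure μ] (hT : MeasurePreserving T μ μ) (hχ : Measurable χ)
    (hmix : ∀ A B : Set Ω, MeasurableSet A → MeasurableSet B →
      Tendsto (fun n => μ (A ∩ T^[n] ⁻¹' B)) atTop (𝓝 (μ A * μ B)))
    {r : ℕ} (hr : Bd μ T χ r 2) {κ : ℝ} (hκ : 1 < κ)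
    (P1 : ∀ ε > 0, ∃ n, Bd μ T χ n (κ + ε))
    (P2 : ∀ ε > 0, ∀ n, ∃ (k l : ℕ) (A B : Set Ω), 1 ≤ k ∧ MeasurableSet[sigmaIcc T χ 1 k] A ∧
      MeasurableSet[sigmaIcc T χ (k + n) l] B ∧ (κ - ε) * μ.real A * μ.real B < μ.real (A ∩ B)) :
    False := by
  obtain ⟨δ, hδ0, hδκ, hδ⟩ : ∃ δ : ℝ, 0 < δ ∧ δ < κ ∧ κ + δ < κ * (κ - δ) := by
    refine ⟨κ * (κ - 1) / (2 * (κ + 1)), by have := sub_pos.2 hκ; positivity, ?_, ?_⟩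
    · rw [div_lt_iff₀ (by positivity)]; nlinarith
    · have h : κ * (κ - 1) / (2 * (κ + 1)) * (2 * (κ + 1)) = κ * (κ - 1) :=
        div_mul_cancel₀ _ (by positivity)
      nlinarith
  have hposof : ∀ {A B : Set Ω} {c : ℝ}, 0 ≤ c → c * μ.real A * μ.real B < μ.real (A ∩ B) →
      0 < μ.real A ∧ 0 < μ.real B := by
    intro A B c hc h
    have h1 : 0 < μ.real (A ∩ B) := lt_of_le_of_lt (by positivity) h
    exact ⟨h1.trans_le (measureReal_mono Set.inter_subset_left),
      h1.trans_le (measureReal_mono Set.inter_subset_right)⟩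
  obtain ⟨n1, hn1⟩ := P1 δ hδ0
  obtain ⟨k1, l1, A1, B1, hk1, hA1, hB1, h1⟩ := P2 δ hδ0 n1
  obtain ⟨hA1p, hB1p⟩ := hposof (by linarith) h1
  set a1 := μ.real A1
  set b1 := μ.real B1
  set q := μ.real (A1 ∩ B1) with hq
  have hkey : (κ + δ) * a1 * b1 < κ * q := by
    have : 0 < a1 * b1 := by positivity
    nlinarith
  obtain ⟨ε, hε0, hεκ, hε⟩ : ∃ ε : ℝ, 0 < ε ∧ ε < κ ∧
      (κ + δ) * (a1 + ε) * (b1 + ε) < (κ + ε) * (q - ε) - 2 * ε := by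
    have hcont : ContinuousAt (fun ε : ℝ => (κ + ε) * (q - ε) - 2 * ε -
      (κ + δ) * (a1 + ε) * (b1 + ε)) 0 := by fun_prop
    have hev : ∀ᶠ ε in 𝓝[>] (0 : ℝ), 0 < (κ + ε) * (q - ε) - 2 * ε -
        (κ + δ) * (a1 + ε) * (b1 + ε) :=
      (hcont.tendsto.eventually (lt_mem_nhds (by simp; linarith))).filter_mono
        nhdsWithin_le_nhds
    have hev2 : ∀ᶠ ε in 𝓝[>] (0 : ℝ), ε < κ :=
      (gt_mem_nhds (by linarith)).filter_mono nhdsWithin_le_nhds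
    obtain ⟨ε, h1, h2, h3⟩ := (hev.and (hev2.and self_mem_nhdsWithin)).exists
    exact ⟨ε, h3, h2, by linarith⟩
  set l := l1 + k1 + n1 with hl
  have hle : ∀ J L, sigmaIcc T χ J L ≤ m0 := fun J L => sigmaIcc_le' hT.measurable hχ J L
  have hA1l : MeasurableSet[sigmaIcc T χ 1 l] A1 :=
    sigmaIcc_mono' le_rfl (by omega) _ hA1
  have hB1l : MeasurableSet[sigmaIcc T χ (k1 + n1) l] B1 :=
    sigmaIcc_mono' le_rfl (by omega) _ hB1
  have hB1l' : MeasurableSet[sigmaIcc T χ 1 l] B1 :=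
    sigmaIcc_mono' (by omega) (by omega) _ hB1
  have hM : MeasurableSet[sigmaIcc T χ 1 l] (A1 ∩ B1) :=
    @MeasurableSet.inter _ (sigmaIcc T χ 1 l) _ _ hA1l hB1l'
  obtain ⟨nε, hnε⟩ := P1 ε hε0
  have hε3 : 0 < ε / 3 := by positivity
  obtain ⟨J, hJ1, hJ2, hJ3, hJ0⟩ := ((avg_mixing hT hmix (hle _ _ _ hA1) hε3).and
    ((avg_mixing hT hmix (hle _ _ _ hB1) hε3).and ((avg_mixing hT hmix (hle _ _ _ hM) hε3).and
    (eventually_gt_atTop 0)))).exists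
  obtain ⟨k2, l2, A2, B2, hk2, hA2, hB2, h2⟩ := P2 ε hε0 (r + J + l + (r + nε))
  obtain ⟨hA2p, hB2p⟩ := hposof (by linarith) h2
  have hdomA : ∀ E, MeasurableSet[sigmaIcc T χ (k2 + r) (k2 + r + J + l)] E →
      μ.real (E ∩ A2) ≤ 2 * μ.real E * μ.real A2 := by
    intro E hE
    have := hr k2 _ A2 E hk2 hA2 hE
    rw [Set.inter_comm]; linarith
  have hdomB : ∀ E, MeasurableSet[sigmaIcc T χ 1 (k2 + r + J + l)] E →
      μ.real (E ∩ B2) ≤ 2 * μ.real E * μ.real B2 := by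
    intro E hE
    exact hr (k2 + r + J + l) l2 E B2 (by omega) hE (sigmaIcc_mono' (by omega) le_rfl _ hB2)
  have e1 := hJ1 _ (hle _ _) A2 hdomA (k2 + r) (fun j hj =>
    sigmaIcc_mono' (by omega) (by omega) _ (sigmaIcc_shift le_rfl (k2 + r + j) hA1l))
  have e2 := hJ2 _ (hle _ _) B2 hdomB (k2 + r) (fun j hj =>
    sigmaIcc_mono' (by omega) (by omega) _ (sigmaIcc_shift le_rfl (k2 + r + j) hB1l'))
  have e3 := hJ3 _ (hle _ _) A2 hdomA (k2 + r) (fun j hj =>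
    sigmaIcc_mono' (by omega) (by omega) _ (sigmaIcc_shift le_rfl (k2 + r + j) hM))
  set a2 := μ.real A2
  set b2 := μ.real B2
  obtain ⟨j, hjm, hj⟩ : ∃ j ∈ Finset.range J,
      |μ.real (T^[k2 + r + j] ⁻¹' A1 ∩ A2) - a1 * a2| / a2 +
      |μ.real (T^[k2 + r + j] ⁻¹' B1 ∩ B2) - b1 * b2| / b2 +
      |μ.real (T^[k2 + r + j] ⁻¹' (A1 ∩ B1) ∩ A2) - q * a2| / a2 ≤ ε := by
    refine Finset.exists_le_of_sum_le (Finset.nonempty_range_iff.2 hJ0.ne') ?_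
    rw [Finset.sum_add_distrib, Finset.sum_add_distrib, ← Finset.sum_div, ← Finset.sum_div,
      ← Finset.sum_div, Finset.sum_const, Finset.card_range, nsmul_eq_mul]
    rw [← div_le_iff₀ hA2p] at e1 e3
    rw [← div_le_iff₀ hB2p] at e2
    linarith
  have hjJ := Finset.mem_range.1 hjm
  have t1 : 0 ≤ |μ.real (T^[k2 + r + j] ⁻¹' A1 ∩ A2) - a1 * a2| / a2 := by positivity
  have t2 : 0 ≤ |μ.real (T^[k2 + r + j] ⁻¹' B1 ∩ B2) - b1 * b2| / b2 := by positivity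
  have t3 : 0 ≤ |μ.real (T^[k2 + r + j] ⁻¹' (A1 ∩ B1) ∩ A2) - q * a2| / a2 := by positivity
  have u1 : |μ.real (T^[k2 + r + j] ⁻¹' A1 ∩ A2) - a1 * a2| ≤ ε * a2 := by
    rw [← div_le_iff₀ hA2p]; linarith
  have u2 : |μ.real (T^[k2 + r + j] ⁻¹' B1 ∩ B2) - b1 * b2| ≤ ε * b2 := by
    rw [← div_le_iff₀ hB2p]; linarith
  have u3 : |μ.real (T^[k2 + r + j] ⁻¹' (A1 ∩ B1) ∩ A2) - q * a2| ≤ ε * a2 := by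
    rw [← div_le_iff₀ hA2p]; linarith
  set s := k2 + r + j with hs
  set A := T^[s] ⁻¹' A1 with hAd
  set B := T^[s] ⁻¹' B1 with hBd
  have hAB : T^[s] ⁻¹' (A1 ∩ B1) = A ∩ B := rfl
  rw [hAB] at u3
  have hA' : MeasurableSet[sigmaIcc T χ 1 (k1 + s)] A :=
    sigmaIcc_mono' (by omega) le_rfl _ (sigmaIcc_shift le_rfl s hA1)
  have hB' : MeasurableSet[sigmaIcc T χ (k1 + s + n1) (l + s)] B :=
    sigmaIcc_mono' (by omega) le_rfl _ (sigmaIcc_shift (by omega) s hB1l)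
  have hM' : MeasurableSet[sigmaIcc T χ 1 (l + s)] (A ∩ B) :=
    sigmaIcc_mono' (by omega) le_rfl _ (sigmaIcc_shift le_rfl s hM)
  have hA2' : ∀ L, k2 ≤ L → MeasurableSet[sigmaIcc T χ 1 L] A2 := fun L hL =>
    sigmaIcc_mono' le_rfl hL _ hA2
  -- grouping (A2, A) against (B, B2)
  have g1 : μ.real ((A2 ∩ A) ∩ (B ∩ B2)) ≤ (κ + δ) * μ.real (A2 ∩ A) * μ.real (B ∩ B2) := by
    refine hn1 (k1 + s) (l + s + l2) _ _ (by omega) ?_ ?_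
    · exact @MeasurableSet.inter _ (sigmaIcc T χ 1 (k1 + s)) _ _ (hA2' _ (by omega)) hA'
    · refine @MeasurableSet.inter _ (sigmaIcc T χ (k1 + s + n1) (l + s + l2)) _ _ ?_ ?_
      · exact sigmaIcc_mono' le_rfl (by omega) _ hB'
      · exact sigmaIcc_mono' (by omega) (by omega) _ hB2
  -- grouping (A2, complement of the middle) against B2
  have g2 : μ.real ((A2 ∩ (A ∩ B)ᶜ) ∩ B2) ≤ (κ + ε) * μ.real (A2 ∩ (A ∩ B)ᶜ) * b2 := by
    refine hnε (l + s) l2 _ _ (by omega) ?_ ?_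
    · refine @MeasurableSet.inter _ (sigmaIcc T χ 1 (l + s)) _ _ (hA2' _ (by omega)) ?_
      exact @MeasurableSet.compl _ _ (sigmaIcc T χ 1 (l + s)) hM'
    · exact sigmaIcc_mono' (by omega) (by omega) _ hB2
  have hMm : MeasurableSet (A ∩ B) := hle _ _ _ hM'
  have s1 : μ.real (A2 ∩ (A ∩ B)) + μ.real (A2 ∩ (A ∩ B)ᶜ) = a2 := by
    rw [← Set.diff_eq]; exact measureReal_inter_add_diff hMm
  have s2 : μ.real ((A2 ∩ A) ∩ (B ∩ B2)) + μ.real ((A2 ∩ (A ∩ B)ᶜ) ∩ B2) = μ.real (A2 ∩ B2) := by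
    have := measureReal_inter_add_diff (μ := μ) (s := A2 ∩ B2) hMm
    rw [← this]
    congr 2
    · ext ω; simp only [Set.mem_inter_iff]; tauto
    · ext ω; simp only [Set.mem_inter_iff, Set.mem_diff, Set.mem_compl_iff]; tauto
  rw [Set.inter_comm] at u1 u3
  rw [abs_le] at u1 u2 u3
  have x1 : μ.real (A2 ∩ A) ≤ (a1 + ε) * a2 := by linarith [u1.2]
  have x2 : μ.real (B ∩ B2) ≤ (b1 + ε) * b2 := by linarith [u2.2]
  have x3 : (q - ε) * a2 ≤ μ.real (A2 ∩ (A ∩ B)) := by linarith [u3.1]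
  have y1 : (κ + δ) * μ.real (A2 ∩ A) * μ.real (B ∩ B2) ≤
      (κ + δ) * ((a1 + ε) * a2) * ((b1 + ε) * b2) := by
    have : 0 ≤ μ.real (B ∩ B2) := measureReal_nonneg
    gcongr
  have y2 : (κ + ε) * ((q - ε) * a2) * b2 ≤ (κ + ε) * μ.real (A2 ∩ (A ∩ B)) * b2 := by gcongr
  have y3 : (κ + ε) * μ.real (A2 ∩ (A ∩ B)ᶜ) * b2 =
      (κ + ε) * a2 * b2 - (κ + ε) * μ.real (A2 ∩ (A ∩ B)) * b2 := by rw [← s1]; ring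
  have y4 : (κ + δ) * (a1 + ε) * (b1 + ε) * (a2 * b2) <
      ((κ + ε) * (q - ε) - 2 * ε) * (a2 * b2) := by
    have : 0 < a2 * b2 := by positivity
    gcongr
  nlinarith

lemma bradley [IsProbabilityMeasure μ] (hT : MeasurePreserving T μ μ) (hχ : Measurable χ)
    (hmix : ∀ A B : Set Ω, MeasurableSet A → MeasurableSet B →
      Tendsto (fun n => μ (A ∩ T^[n] ⁻¹' B)) atTop (𝓝 (μ A * μ B)))
    {r : ℕ} (hr : Bd μ T χ r 2) {ε : ℝ} (hε : 0 < ε) : ∃ n, Bd μ T χ n (1 + ε) := by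
  set S : Set ℝ := {K | 1 ≤ K ∧ ∃ n, Bd μ T χ n K} with hS
  have hne : S.Nonempty := ⟨2, by norm_num, r, hr⟩
  have hbdd : BddBelow S := ⟨1, fun K hK => hK.1⟩
  have P1 : ∀ ε > 0, ∃ n, Bd μ T χ n (sInf S + ε) := by
    intro ε hε
    obtain ⟨K, hK, hlt⟩ := exists_lt_of_csInf_lt hne (lt_add_of_pos_right (sInf S) hε)
    obtain ⟨n, hn⟩ := hK.2
    exact ⟨n, hn.mono le_rfl hlt.le⟩
  by_cases hκ : 1 < sInf S
  · exfalso
    refine bradley_step hT hχ hmix hr hκ P1 ?_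
    intro ε hε n
    by_contra hcon
    push Not at hcon
    have hB : Bd μ T χ n (sInf S - ε) := fun k l A B hk hA hB => hcon k l A B hk hA hB
    have hmem : max 1 (sInf S - ε) ∈ S := ⟨le_max_left _ _, n, hB.mono le_rfl (le_max_right _ _)⟩
    have := csInf_le hbdd hmem
    have h2 : max 1 (sInf S - ε) < sInf S := max_lt hκ (by linarith)
    linarith
  · obtain ⟨n, hn⟩ := P1 ε hε
    exact ⟨n, hn.mono le_rfl (by linarith)⟩

open ProbabilityTheory in
lemma variance_joint [IsProbabilityMeasure μ] {N N' : Ω → ℕ} (hN : Measurable N)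
    (hN' : Measurable N') {b : ℕ} (hNb : ∀ ω, N ω ≤ b) (hNb' : ∀ ω, N' ω ≤ b) {K : ℝ} (hK : 0 ≤ K)
    (h : ∀ i j, μ.real (N ⁻¹' {i} ∩ N' ⁻¹' {j}) ≤ K * μ.real (N ⁻¹' {i}) * μ.real (N' ⁻¹' {j})) :
    Var[fun ω => (N ω : ℝ) + (N' ω : ℝ); μ] ≤
      K * (Var[fun ω => (N ω : ℝ); μ] + Var[fun ω => (N' ω : ℝ); μ]) := by
  have hX : MemLp (fun ω => (N ω : ℝ)) 2 μ :=
    MemLp.of_bound (measurable_from_nat.comp hN).aestronglyMeasurable (b : ℝ)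
      (ae_of_all _ fun ω => by simpa using hNb ω)
  have hY : MemLp (fun ω => (N' ω : ℝ)) 2 μ :=
    MemLp.of_bound (measurable_from_nat.comp hN').aestronglyMeasurable (b : ℝ)
      (ae_of_all _ fun ω => by simpa using hNb' ω)
  have hX1 := hX.integrable (by norm_num)
  have hY1 := hY.integrable (by norm_num)
  rw [← variance_add_prod hX hY]
  have hXp : MemLp (fun p : Ω × Ω => (N p.1 : ℝ)) 2 (μ.prod μ) := hX.comp_fst μ
  have hYp : MemLp (fun p : Ω × Ω => (N' p.2 : ℝ)) 2 (μ.prod μ) := hY.comp_snd μ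
  have hXY : MemLp (fun ω => (N ω : ℝ) + (N' ω : ℝ)) 2 μ := hX.add hY
  have hXYp : MemLp (fun p : Ω × Ω => (N p.1 : ℝ) + (N' p.2 : ℝ)) 2 (μ.prod μ) := hXp.add hYp
  set c : ℝ := ∫ ω, ((N ω : ℝ) + (N' ω : ℝ)) ∂μ with hc
  have hcp : ∫ p : Ω × Ω, ((N p.1 : ℝ) + (N' p.2 : ℝ)) ∂(μ.prod μ) = c := by
    rw [hc, integral_add hX1 hY1, integral_add (hXp.integrable (by norm_num))
      (hYp.integrable (by norm_num)), integral_fun_fst (fun ω => (N ω : ℝ)),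
      integral_fun_snd (fun ω => (N' ω : ℝ))]
    simp
  rw [← ENNReal.ofReal_le_ofReal_iff (mul_nonneg hK (variance_nonneg _ _)), ENNReal.ofReal_mul hK,
    ofReal_variance hXY, ofReal_variance hXYp, evariance_eq_lintegral_ofReal,
    evariance_eq_lintegral_ofReal, hcp, ← hc]
  set G : ℕ × ℕ → ℝ≥0∞ := fun q => ENNReal.ofReal (((q.1 : ℝ) + (q.2 : ℝ) - c) ^ 2) with hG
  have hGm : Measurable G := measurable_of_countable _
  have hm1 : Measurable fun ω => (N ω, N' ω) := hN.prodMk hN'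
  have hm2 : Measurable fun p : Ω × Ω => (N p.1, N' p.2) :=
    (hN.comp measurable_fst).prodMk (hN'.comp measurable_snd)
  have e1 : ∫⁻ ω, ENNReal.ofReal (((N ω : ℝ) + (N' ω : ℝ) - c) ^ 2) ∂μ
      = ∫⁻ q, G q ∂(μ.map fun ω => (N ω, N' ω)) := by
    rw [lintegral_map hGm hm1]
  have e2 : ∫⁻ p : Ω × Ω, ENNReal.ofReal (((N p.1 : ℝ) + (N' p.2 : ℝ) - c) ^ 2) ∂(μ.prod μ)
      = ∫⁻ q, G q ∂((μ.prod μ).map fun p => (N p.1, N' p.2)) := by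
    rw [lintegral_map hGm hm2]
  rw [e1, e2, lintegral_countable', lintegral_countable', ← ENNReal.tsum_mul_left]
  refine ENNReal.tsum_le_tsum fun q => ?_
  rw [Measure.map_apply hm1 (measurableSet_singleton _),
    Measure.map_apply hm2 (measurableSet_singleton _)]
  have s1 : (fun ω => (N ω, N' ω)) ⁻¹' {q} = N ⁻¹' {q.1} ∩ N' ⁻¹' {q.2} := by
    ext ω; simp [Prod.ext_iff]
  have s2 : (fun p : Ω × Ω => (N p.1, N' p.2)) ⁻¹' {q} = (N ⁻¹' {q.1}) ×ˢ (N' ⁻¹' {q.2}) := by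
    ext ω; simp [Prod.ext_iff]
  rw [s1, s2, Measure.prod_prod, mul_left_comm]
  gcongr
  rw [← ofReal_measureReal, ← ofReal_measureReal (s := N ⁻¹' {q.1}),
    ← ofReal_measureReal (s := N' ⁻¹' {q.2}), ← ENNReal.ofReal_mul (by positivity),
    ← ENNReal.ofReal_mul (by positivity)]
  apply ENNReal.ofReal_le_ofReal
  rw [← mul_assoc]
  exact h _ _

/-- number of exceedances over `g` in the time window `[s, s+n)` -/
noncomputable def cnt (T : Ω → Ω) (χ : Ω → ℝ) (g : ℝ) (s n : ℕ) (ω : Ω) : ℕ :=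
  ∑ j ∈ Finset.range n, if g < χ (T^[s + j] ω) then 1 else 0

lemma meas_cnt_aux {Ω : Type*} [MeasurableSpace Ω] {n : ℕ} {X : ℕ → Ω → ℝ} (g : ℝ)
    (hX : ∀ j < n, Measurable (X j)) :
    Measurable fun ω => ∑ j ∈ Finset.range n, if g < X j ω then 1 else 0 := by
  refine Finset.measurable_fun_sum _ fun j hj => ?_
  exact Measurable.ite (measurableSet_lt measurable_const (hX j (Finset.mem_range.1 hj)))
    measurable_const measurable_const

lemma meas_cnt (g : ℝ) (s n : ℕ) {J L : ℕ} (hJ : J ≤ s + 1) (hL : s + n ≤ L) :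
    Measurable[sigmaIcc T χ J L] (cnt T χ g s n) := by
  refine @meas_cnt_aux Ω (sigmaIcc T χ J L) n (fun j ω => χ (T^[s + j] ω)) g fun j hj => ?_
  have := measurable_X (T := T) (χ := χ) (J := J) (L := L) (k := s + j + 1)
    ⟨by omega, by omega⟩
  simpa using this

lemma cnt_le (g : ℝ) (s n : ℕ) (ω : Ω) : cnt T χ g s n ω ≤ n := by
  unfold cnt
  refine (Finset.sum_le_sum (g := fun _ => 1) fun j _ => ?_).trans (by simp)
  split_ifs <;> simp

lemma cnt_add (g : ℝ) (s a b : ℕ) (ω : Ω) :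
    cnt T χ g s (a + b) ω = cnt T χ g s a ω + cnt T χ g (s + a) b ω := by
  unfold cnt
  rw [Finset.sum_range_add]
  simp [add_assoc]

lemma cnt_shift (g : ℝ) (s n : ℕ) (ω : Ω) : cnt T χ g s n ω = cnt T χ g 0 n (T^[s] ω) := by
  unfold cnt
  simp [← Function.iterate_add_apply, add_comm]

lemma meas_cnt0 (hT : Measurable T) (hχ : Measurable χ) (g : ℝ) (s n : ℕ) :
    Measurable (cnt T χ g s n) :=
  (meas_cnt (J := s + 1) (L := s + n) g s n le_rfl le_rfl).mono (sigmaIcc_le' hT hχ _ _) le_rfl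

lemma memLp_cnt [IsProbabilityMeasure μ] (hT : Measurable T) (hχ : Measurable χ) (g : ℝ)
    (s n : ℕ) : MemLp (fun ω => (cnt T χ g s n ω : ℝ)) 2 μ :=
  MemLp.of_bound (measurable_from_nat.comp (meas_cnt0 hT hχ g s n)).aestronglyMeasurable (n : ℝ)
    (ae_of_all _ fun ω => by simpa using cnt_le g s n ω)

open ProbabilityTheory in
lemma var_shift [IsProbabilityMeasure μ] (hT : MeasurePreserving T μ μ) (hχ : Measurable χ)
    (g : ℝ) (s n : ℕ) :
    Var[fun ω => (cnt T χ g s n ω : ℝ); μ] = Var[fun ω => (cnt T χ g 0 n ω : ℝ); μ] := by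
  have he : (fun ω => (cnt T χ g s n ω : ℝ)) = fun ω => (cnt T χ g 0 n (T^[s] ω) : ℝ) := by
    ext ω; rw [cnt_shift]
  rw [he]
  have hm : AEMeasurable (fun ω => (cnt T χ g 0 n ω : ℝ)) μ :=
    (memLp_cnt hT.measurable hχ g 0 n).aestronglyMeasurable.aemeasurable
  exact (hT.iterate s).variance_fun_comp (f := fun ω => (cnt T χ g 0 n ω : ℝ)) hm

open ProbabilityTheory in
lemma var_le_sq [IsProbabilityMeasure μ] (hT : MeasurePreserving T μ μ) (hχ : Measurable χ)
    (g : ℝ) (s n : ℕ) : Var[fun ω => (cnt T χ g s n ω : ℝ); μ] ≤ (n : ℝ) ^ 2 := by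
  refine (variance_le_expectation_sq (memLp_cnt hT.measurable hχ g s n).aestronglyMeasurable).trans ?_
  refine (integral_mono (memLp_cnt hT.measurable hχ g s n).integrable_sq
    (integrable_const ((n : ℝ) ^ 2)) fun ω => ?_).trans (by simp)
  have : (cnt T χ g s n ω : ℝ) ≤ n := by exact_mod_cast cnt_le g s n ω
  simp only [Pi.pow_apply]
  gcongr

open ProbabilityTheory in
lemma var_rec [IsProbabilityMeasure μ] (hT : MeasurePreserving T μ μ) (hχ : Measurable χ)
    {n0 : ℕ} (hB : Bd μ T χ n0 (17 / 16)) (g : ℝ) {h d : ℕ} (hh : 1 ≤ h) (hd : n0 ≤ d) :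
    Var[fun ω => (cnt T χ g 0 (h + d + h) ω : ℝ); μ] ≤
      9 / 4 * Var[fun ω => (cnt T χ g 0 h ω : ℝ); μ] + 18 * (d : ℝ) ^ 2 := by
  set S : Ω → ℝ := fun ω => (cnt T χ g 0 h ω : ℝ) + (cnt T χ g (h + d) h ω : ℝ) with hS
  set M : Ω → ℝ := fun ω => (cnt T χ g h d ω : ℝ) with hM
  have e : (fun ω => (cnt T χ g 0 (h + d + h) ω : ℝ)) = fun ω => S ω + M ω := by
    ext ω
    rw [cnt_add, cnt_add]
    simp only [hS, hM, zero_add]; push_cast; ring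
  have hSL : MemLp S 2 μ := (memLp_cnt hT.measurable hχ g 0 h).add
    (memLp_cnt hT.measurable hχ g (h + d) h)
  have hML : MemLp M 2 μ := memLp_cnt hT.measurable hχ g h d
  rw [e, variance_fun_add hSL hML]
  have h17 : MemLp (fun ω => 17 * M ω) 2 μ := hML.const_mul 17
  have h0 : 0 ≤ Var[fun ω => S ω - 17 * M ω; μ] := variance_nonneg _ _
  rw [variance_fun_sub hSL h17, variance_const_mul, covariance_const_mul_right] at h0
  have hSV : Var[S; μ] ≤ 17 / 16 * (Var[fun ω => (cnt T χ g 0 h ω : ℝ); μ] +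
      Var[fun ω => (cnt T χ g (h + d) h ω : ℝ); μ]) := by
    refine variance_joint (b := h) (meas_cnt0 hT.measurable hχ g 0 h)
      (meas_cnt0 hT.measurable hχ g _ h) (cnt_le g 0 h) (cnt_le g _ h) (by norm_num) ?_
    intro i j
    refine hB h (h + d + h) _ _ hh ?_ ?_
    · exact meas_cnt (J := 1) (L := h) g 0 h (by omega) (by omega) (measurableSet_singleton i)
    · exact meas_cnt (J := h + n0) (L := h + d + h) g (h + d) h (by omega) (by omega)
        (measurableSet_singleton j)
  rw [var_shift hT hχ g (h + d) h] at hSV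
  have hMV : Var[M; μ] ≤ (d : ℝ) ^ 2 := var_le_sq hT hχ g h d
  linarith

lemma cnt_eq_ind (g : ℝ) (n : ℕ) (ω : Ω) : (cnt T χ g 0 n ω : ℝ) =
    ∑ j ∈ Finset.range n, (T^[j] ⁻¹' {ω | g < χ ω}).indicator (1 : Ω → ℝ) ω := by
  unfold cnt
  push_cast
  refine Finset.sum_congr rfl fun j _ => ?_
  by_cases h : g < χ (T^[j] ω)
  · rw [Set.indicator_of_mem (by simpa using h)]
    simp [h]
  · rw [Set.indicator_of_notMem (by simpa using h)]
    simp [h]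

lemma mean_cnt [IsProbabilityMeasure μ] (hT : MeasurePreserving T μ μ) (hχ : Measurable χ)
    (g : ℝ) (n : ℕ) : ∫ ω, (cnt T χ g 0 n ω : ℝ) ∂μ = n * μ.real {ω | g < χ ω} := by
  have hA : MeasurableSet {ω | g < χ ω} := measurableSet_lt measurable_const hχ
  have hAj : ∀ j, MeasurableSet (T^[j] ⁻¹' {ω | g < χ ω}) := fun j =>
    (hT.measurable.iterate j) hA
  simp only [cnt_eq_ind]
  have hI : ∀ j, Integrable ((T^[j] ⁻¹' {ω | g < χ ω}).indicator (1 : Ω → ℝ)) μ := fun j =>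
    (integrable_const (1 : ℝ)).indicator (hAj j)
  rw [integral_finset_sum _ fun j _ => hI j]
  rw [Finset.sum_congr rfl fun j _ => integral_indicator_one (hAj j)]
  have : ∀ j, μ.real (T^[j] ⁻¹' {ω | g < χ ω}) = μ.real {ω | g < χ ω} := fun j => by
    simp only [Measure.real]
    rw [(hT.iterate j).measure_preimage hA.nullMeasurableSet]
  rw [Finset.sum_congr rfl fun j _ => this j]
  simp

open ProbabilityTheory in
lemma var_base [IsProbabilityMeasure μ] (hT : MeasurePreserving T μ μ) (hχ : Measurable χ)
    {r : ℕ} (hr : Bd μ T χ r 2) (g : ℝ) (n : ℕ) (hn : n * μ.real {ω | g < χ ω} ≤ 1) :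
    Var[fun ω => (cnt T χ g 0 n ω : ℝ); μ] ≤ 2 + 2 * r := by
  set A := {ω | g < χ ω} with hAdef
  set p := μ.real A with hp
  have hp0 : 0 ≤ p := measureReal_nonneg
  have hA : MeasurableSet A := measurableSet_lt measurable_const hχ
  set Aj : ℕ → Set Ω := fun j => T^[j] ⁻¹' A with hAj
  have hAjm : ∀ j, MeasurableSet (Aj j) := fun j => (hT.measurable.iterate j) hA
  have hAjp : ∀ j, μ.real (Aj j) = p := fun j => by
    simp only [Measure.real, hp, hAj]
    rw [(hT.iterate j).measure_preimage hA.nullMeasurableSet]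
  have hAs : ∀ j, MeasurableSet[sigmaIcc T χ (j + 1) (j + 1)] (Aj j) := fun j => by
    have := measurable_X (T := T) (χ := χ) (J := j + 1) (L := j + 1) (k := j + 1)
      ⟨le_rfl, le_rfl⟩ (measurableSet_Ioi (a := g))
    simp only [Nat.add_sub_cancel] at this
    exact this
  have hfar' : ∀ i j, i + r ≤ j → μ.real (Aj i ∩ Aj j) ≤ 2 * p * p := fun i j hij => by
    have := hr (i + 1) (j + 1) (Aj i) (Aj j) (by omega)
      (sigmaIcc_mono' (by omega) le_rfl _ (hAs i)) (sigmaIcc_mono' (by omega) le_rfl _ (hAs j))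
    rwa [hAjp, hAjp] at this
  have hfar : ∀ i j, μ.real (Aj i ∩ Aj j) ≤
      2 * p * p + (if j ∈ Finset.Ico (i + 1 - r) (i + r) then p else 0) := fun i j => by
    by_cases hm : j ∈ Finset.Ico (i + 1 - r) (i + r)
    · rw [if_pos hm]
      have : μ.real (Aj i ∩ Aj j) ≤ p := (measureReal_mono Set.inter_subset_left).trans (hAjp i).le
      nlinarith
    · rw [if_neg hm, add_zero]
      rw [Finset.mem_Ico] at hm
      by_cases h1 : i + r ≤ j
      · exact hfar' i j h1
      · rw [Set.inter_comm]; exact hfar' j i (by omega)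
  have hIind : ∀ (S : Set Ω), MeasurableSet S → Integrable (S.indicator (1 : Ω → ℝ)) μ :=
    fun S hS => (integrable_const (1 : ℝ)).indicator hS
  refine (variance_le_expectation_sq
    (memLp_cnt hT.measurable hχ g 0 n).aestronglyMeasurable).trans ?_
  have e : ∀ ω, (cnt T χ g 0 n ω : ℝ) ^ 2 = ∑ i ∈ Finset.range n, ∑ j ∈ Finset.range n,
      (Aj i ∩ Aj j).indicator (1 : Ω → ℝ) ω := fun ω => by
    rw [cnt_eq_ind, sq, Finset.sum_mul_sum]
    refine Finset.sum_congr rfl fun i _ => Finset.sum_congr rfl fun j _ => ?_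
    rw [Set.inter_indicator_one]; rfl
  have e' : ∫ ω, ((fun ω => (cnt T χ g 0 n ω : ℝ)) ^ 2) ω ∂μ =
      ∑ i ∈ Finset.range n, ∑ j ∈ Finset.range n, μ.real (Aj i ∩ Aj j) := by
    simp only [Pi.pow_apply, e]
    rw [integral_finset_sum _ fun i _ => integrable_finset_sum _ fun j _ =>
      hIind _ ((hAjm i).inter (hAjm j))]
    refine Finset.sum_congr rfl fun i _ => ?_
    rw [integral_finset_sum _ fun j _ => hIind _ ((hAjm i).inter (hAjm j))]
    exact Finset.sum_congr rfl fun j _ => integral_indicator_one ((hAjm i).inter (hAjm j))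
  rw [e']
  have h1 : ∀ i ∈ Finset.range n, ∑ j ∈ Finset.range n, μ.real (Aj i ∩ Aj j) ≤
      n * (2 * p * p) + 2 * r * p := by
    intro i _
    refine (Finset.sum_le_sum fun j _ => hfar i j).trans ?_
    rw [Finset.sum_add_distrib, Finset.sum_const, Finset.card_range, nsmul_eq_mul,
      Finset.sum_ite_mem, Finset.sum_const, nsmul_eq_mul]
    gcongr
    have : (Finset.range n ∩ Finset.Ico (i + 1 - r) (i + r)).card ≤ 2 * r := by
      refine (Finset.card_le_card Finset.inter_subset_right).trans ?_
      rw [Nat.card_Ico]; omega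
    exact_mod_cast this
  refine (Finset.sum_le_sum h1).trans ?_
  rw [Finset.sum_const, Finset.card_range, nsmul_eq_mul]
  have h2 : 0 ≤ n * p := by positivity
  have h3 : (n * p) * (n * p) ≤ 1 := by nlinarith
  have h4 : (r : ℝ) * (n * p) ≤ r := by
    have : (0 : ℝ) ≤ r := by positivity
    nlinarith
  nlinarith

open ProbabilityTheory in
lemma var_main [IsProbabilityMeasure μ] (hT : MeasurePreserving T μ μ) (hχ : Measurable χ)
    (hmix : ∀ A B : Set Ω, MeasurableSet A → MeasurableSet B →
      Tendsto (fun n => μ (A ∩ T^[n] ⁻¹' B)) atTop (𝓝 (μ A * μ B)))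
    {r : ℕ} (hr : Bd μ T χ r 2) : ∃ C : ℝ, 0 ≤ C ∧ ∀ (i : ℕ) (g : ℝ) (n : ℕ),
      n * μ.real {ω | g < χ ω} ≤ 2 ^ i →
      Var[fun ω => (cnt T χ g 0 n ω : ℝ); μ] ≤ C * (9 / 4) ^ i := by
  obtain ⟨n0, hn0⟩ := bradley hT hχ hmix hr (ε := 1 / 16) (by norm_num)
  norm_num at hn0
  set D : ℝ := 15 * ((n0 : ℝ) + 1) ^ 2 with hD
  set C : ℝ := 2 + 2 * r + ((n0 : ℝ) + 1) ^ 2 + D with hC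
  have hD0 : 0 ≤ D := by positivity
  have hC0 : 0 ≤ C := by positivity
  refine ⟨C, hC0, ?_⟩
  suffices H : ∀ (i : ℕ) (g : ℝ) (n : ℕ), n * μ.real {ω | g < χ ω} ≤ 2 ^ i →
      Var[fun ω => (cnt T χ g 0 n ω : ℝ); μ] ≤ C * (9 / 4) ^ i - D from
    fun i g n h => (H i g n h).trans (by linarith)
  have hsq : (0 : ℝ) ≤ ((n0 : ℝ) + 1) ^ 2 := by positivity
  have hr0 : (0 : ℝ) ≤ r := by positivity
  intro i
  induction i with
  | zero =>
    intro g n h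
    have := var_base hT hχ hr g n (by simpa using h)
    rw [pow_zero, mul_one]
    linarith
  | succ i ih =>
    intro g n h
    by_cases hsmall : n ≤ n0 + 1
    · have h1 := var_le_sq hT hχ (μ := μ) g 0 n
      have h2 : (n : ℝ) ^ 2 ≤ ((n0 : ℝ) + 1) ^ 2 := by
        have : (n : ℝ) ≤ n0 + 1 := by exact_mod_cast hsmall
        gcongr
      have h3 : (1 : ℝ) ≤ (9 / 4) ^ (i + 1) := one_le_pow₀ (by norm_num)
      have h4 : C * 1 ≤ C * (9 / 4) ^ (i + 1) := by gcongr
      linarith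
    · obtain ⟨k, d, hk, hd1, hd2, hn⟩ : ∃ k d : ℕ, 1 ≤ k ∧ n0 ≤ d ∧ d ≤ n0 + 1 ∧
          n = k + d + k :=
        ⟨(n - n0) / 2, n - 2 * ((n - n0) / 2), by omega, by omega, by omega, by omega⟩
      have hrec := var_rec hT hχ hn0 g hk hd1
      rw [← hn] at hrec
      have hp0 : 0 ≤ μ.real {ω | g < χ ω} := measureReal_nonneg
      have hkn : 2 * (k : ℝ) ≤ n := by
        have : 2 * k ≤ n := by omega
        exact_mod_cast this
      have hk2 := ih g k (by
        rw [pow_succ] at h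
        nlinarith)
      have h2 : (d : ℝ) ^ 2 ≤ ((n0 : ℝ) + 1) ^ 2 := by
        have : (d : ℝ) ≤ n0 + 1 := by exact_mod_cast hd2
        gcongr
      rw [pow_succ]
      linarith

lemma distF_eq_cdf [IsProbabilityMeasure μ] (hχ : Measurable χ) (x : ℝ) :
    distF μ χ x = ProbabilityTheory.cdf (μ.map χ) x := by
  haveI : IsProbabilityMeasure (μ.map χ) := Measure.isProbabilityMeasure_map hχ.aemeasurable
  rw [ProbabilityTheory.cdf_eq_real, Measure.real, Measure.map_apply hχ measurableSet_Iic]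
  rfl

lemma distF_compl [IsProbabilityMeasure μ] (hχ : Measurable χ) (x : ℝ) :
    μ.real {ω | x < χ ω} = 1 - distF μ χ x := by
  have h : {ω | x < χ ω} = {ω | χ ω ≤ x}ᶜ := by ext ω; simp
  rw [h, probReal_compl_eq_one_sub (measurableSet_le hχ measurable_const)]
  rfl

lemma genInv_facts [IsProbabilityMeasure μ] (hχ : Measurable χ) {y : ℝ} (hy0 : 0 < y)
    (hy1 : y < 1) : y ≤ distF μ χ (genInv (distF μ χ) y) ∧
      ∀ X, distF μ χ X < y → X ≤ genInv (distF μ χ) y := by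
  have hF : distF μ χ = ProbabilityTheory.cdf (μ.map χ) := funext (distF_eq_cdf hχ)
  rw [hF]
  set F := ProbabilityTheory.cdf (μ.map χ) with hFd
  have hmono : Monotone F := ProbabilityTheory.monotone_cdf _
  have hne : {x : ℝ | y ≤ F x}.Nonempty :=
    ((ProbabilityTheory.tendsto_cdf_atTop (μ.map χ)).eventually (eventually_ge_nhds hy1)).exists
  have hlow : ∀ X, F X < y → ∀ x ∈ {x : ℝ | y ≤ F x}, X ≤ x := fun X hX x hx => by
    by_contra hlt
    have := hmono (not_le.1 hlt).le
    simp only [Set.mem_setOf_eq] at hx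
    linarith
  have hbdd : BddBelow {x : ℝ | y ≤ F x} := by
    obtain ⟨X, hX⟩ := ((ProbabilityTheory.tendsto_cdf_atBot (μ.map χ)).eventually
      (eventually_lt_nhds hy0)).exists
    exact ⟨X, hlow X hX⟩
  refine ⟨?_, fun X hX => le_csInf hne (hlow X hX)⟩
  have hrc : Tendsto F (𝓝[>] (genInv F y)) (𝓝 (F (genInv F y))) :=
    (F.right_continuous _).mono_left (nhdsWithin_mono _ Set.Ioi_subset_Ici_self)
  refine ge_of_tendsto hrc ?_
  filter_upwards [self_mem_nhdsWithin] with x hx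
  obtain ⟨x', hx', hlt⟩ := exists_lt_of_csInf_lt hne hx
  exact hx'.trans (hmono hlt.le)

open ProbabilityTheory in
lemma cheb_bound [IsProbabilityMeasure μ] (hT : MeasurePreserving T μ μ) (hχ : Measurable χ)
    {C : ℝ} (hC : 0 ≤ C) (hV : ∀ (i : ℕ) (g : ℝ) (n : ℕ),
      n * μ.real {ω | g < χ ω} ≤ 2 ^ i →
      Var[fun ω => (cnt T χ g 0 n ω : ℝ); μ] ≤ C * (9 / 4) ^ i)
    (r b n : ℕ) (g : ℝ) (hb : 1 ≤ b)
    (hn : n * μ.real {ω | g < χ ω} ≤ (b : ℝ) - (b : ℝ) ^ ((2 : ℝ) / 3))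
    (hs : 4 * (r : ℝ) ≤ (b : ℝ) ^ ((2 : ℝ) / 3)) :
    μ.real {ω | (b : ℝ) - 2 * r + 1 < (cnt T χ g 0 n ω : ℝ)} ≤
      C * 4 * (2 : ℝ) ^ ((5 : ℝ) / 4) * (b : ℝ) ^ (-((1 : ℝ) / 12)) := by
  have hb0 : (0 : ℝ) < b := by exact_mod_cast hb
  set s := (b : ℝ) ^ ((2 : ℝ) / 3) with hsdef
  have hs0 : 0 < s := Real.rpow_pos_of_pos hb0 _
  set i := Nat.clog 2 b with hi
  have hi1 : (b : ℝ) ≤ 2 ^ i := by exact_mod_cast Nat.le_pow_clog (by norm_num) b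
  have hi2 : (2 : ℝ) ^ i ≤ 2 * b := by
    rcases Nat.lt_or_ge 1 b with h | h
    · have h1 : 2 ^ (i - 1) < b := Nat.pow_pred_clog_lt_self (by norm_num) h
      have h2 : 0 < i := Nat.clog_pos (by norm_num) h
      have h3 : 2 ^ i = 2 * 2 ^ (i - 1) := by
        rw [← pow_succ']; congr 1; omega
      have : 2 ^ i ≤ 2 * b := by omega
      exact_mod_cast this
    · have : b = 1 := by omega
      rw [hi, this]; norm_num
  have hV' := hV i g n (by linarith)
  have hpow : ((9 : ℝ) / 4) ^ i ≤ (2 * (b : ℝ)) ^ ((5 : ℝ) / 4) := by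
    have h1 : ((9 : ℝ) / 4) ≤ (2 : ℝ) ^ ((5 : ℝ) / 4) := by
      have h4 : ((2 : ℝ) ^ ((5 : ℝ) / 4)) ^ 4 = 32 := by
        rw [← Real.rpow_natCast, ← Real.rpow_mul (by norm_num)]
        norm_num
      refine le_of_pow_le_pow_left₀ (n := 4) (by norm_num) (by positivity) ?_
      rw [h4]; norm_num
    calc ((9 : ℝ) / 4) ^ i ≤ ((2 : ℝ) ^ ((5 : ℝ) / 4)) ^ i := by gcongr
      _ = ((2 : ℝ) ^ i) ^ ((5 : ℝ) / 4) := by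
        rw [← Real.rpow_natCast, ← Real.rpow_natCast, ← Real.rpow_mul (by norm_num),
          ← Real.rpow_mul (by norm_num), mul_comm]
      _ ≤ _ := by gcongr
  have hch := meas_ge_le_variance_div_sq (memLp_cnt (μ := μ) hT.measurable hχ g 0 n)
    (c := s / 2) (by positivity)
  rw [mean_cnt hT hχ] at hch
  have hsub : {ω | (b : ℝ) - 2 * r + 1 < (cnt T χ g 0 n ω : ℝ)} ⊆
      {ω | s / 2 ≤ |(cnt T χ g 0 n ω : ℝ) - n * μ.real {ω | g < χ ω}|} := by
    intro ω hω
    simp only [Set.mem_setOf_eq] at hω ⊢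
    refine le_trans ?_ (le_abs_self _)
    linarith
  have h1 : μ.real {ω | (b : ℝ) - 2 * r + 1 < (cnt T χ g 0 n ω : ℝ)} ≤
      Var[fun ω => (cnt T χ g 0 n ω : ℝ); μ] / (s / 2) ^ 2 := by
    refine ENNReal.toReal_le_of_le_ofReal (div_nonneg (variance_nonneg _ _) (by positivity)) ?_
    exact (measure_mono hsub).trans hch
  refine h1.trans ?_
  rw [div_le_iff₀ (by positivity)]
  refine hV'.trans ((mul_le_mul_of_nonneg_left hpow hC).trans (le_of_eq ?_))
  rw [Real.mul_rpow (by norm_num) hb0.le]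
  have h2 : (b : ℝ) ^ ((5 : ℝ) / 4) = (b : ℝ) ^ (-((1 : ℝ) / 12)) * s ^ 2 := by
    rw [hsdef, ← Real.rpow_natCast, ← Real.rpow_mul hb0.le, ← Real.rpow_add hb0]
    norm_num
  rw [h2]; ring

lemma card_eq_cnt (g : ℝ) (n : ℕ) (ω : Ω) :
    ((Finset.Icc 1 n).filter fun j => g < χ (T^[j - 1] ω)).card = cnt T χ g 0 n ω := by
  unfold cnt
  rw [Finset.card_filter]
  refine Finset.sum_nbij' (fun j => j - 1) (fun j => j + 1) ?_ ?_ ?_ ?_ ?_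
  · intro j hj; simp only [Finset.mem_Icc, Finset.mem_range] at hj ⊢; omega
  · intro j hj; simp only [Finset.mem_Icc, Finset.mem_range] at hj ⊢; omega
  · intro j hj; simp only [Finset.mem_Icc] at hj ⊢; omega
  · intro j hj; simp
  · intro j hj; simp

lemma integrable_trunc [IsProbabilityMeasure μ] (hχ : Measurable χ) (h0 : ∀ ω, 0 ≤ χ ω) (f : ℝ) :
    Integrable (fun ω => if χ ω ≤ f then χ ω else 0) μ := by
  refine Integrable.of_bound (Measurable.ite (measurableSet_le hχ measurable_const) hχ
    measurable_const).aestronglyMeasurable |f| (ae_of_all _ fun ω => ?_)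
  split_ifs with h
  · rw [Real.norm_eq_abs, abs_of_nonneg (h0 ω)]
    exact h.trans (le_abs_self f)
  · simp

lemma integral_truncSumN [IsProbabilityMeasure μ] (hT : MeasurePreserving T μ μ)
    (hχ : Measurable χ) (h0 : ∀ ω, 0 ≤ χ ω) (n : ℕ) (f : ℝ) :
    ∫ ω, truncSumN T χ n f ω ∂μ = n * ∫ ω, (if χ ω ≤ f then χ ω else 0) ∂μ := by
  have hI := integrable_trunc (μ := μ) hχ h0 f
  unfold truncSumN
  rw [integral_finset_sum]
  · have : ∀ k, ∫ ω, (if χ (T^[k] ω) ≤ f then χ (T^[k] ω) else 0) ∂μ =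
        ∫ ω, (if χ ω ≤ f then χ ω else 0) ∂μ := fun k => by
      have hk := hT.iterate k
      conv_rhs => rw [← hk.map_eq]
      rw [integral_map hk.measurable.aemeasurable]
      rw [hk.map_eq]
      exact hI.aestronglyMeasurable
    rw [Finset.sum_congr rfl fun k _ => this k]
    simp
  · intro k _
    exact (hT.iterate k).integrable_comp_of_integrable hI

lemma ratio_bound [IsProbabilityMeasure μ] (hχ : Measurable χ) (h0 : ∀ ω, 0 ≤ χ ω)
    {L : ℝ → ℝ} (hL : SlowlyVarying L) (hLpos : ∀ x : ℝ, 0 < x → 0 < L x)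
    {α : ℝ} (hα0 : 0 < α)
    (htail : ∀ x : ℝ, 0 < x → μ.real {ω | x < χ ω} = L x / x ^ α) :
    ∃ C : ℝ, ∀ᶠ x in atTop, 0 < ∫ ω, (if χ ω ≤ x then χ ω else 0) ∂μ ∧
      ∫ ω, (if χ ω ≤ 2 * x then χ ω else 0) ∂μ ≤
        C * ∫ ω, (if χ ω ≤ x then χ ω else 0) ∂μ := by
  have h2 : (1 : ℝ) < 2 ^ α := Real.one_lt_rpow (by norm_num) hα0
  set δ : ℝ := ((2 : ℝ) ^ α - 1) / 2 with hδ
  have hδ0 : 0 < δ := by rw [hδ]; linarith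
  have hlim : Tendsto (fun x => L (1 / 2 * x) / L x * 2 ^ α) atTop (𝓝 (2 ^ α)) := by
    simpa using (hL (1 / 2) (by norm_num)).mul_const ((2 : ℝ) ^ α)
  refine ⟨1 + 4 / δ, ?_⟩
  filter_upwards [hlim.eventually (eventually_ge_nhds (show 1 + δ < 2 ^ α by rw [hδ]; linarith)),
    eventually_gt_atTop 0] with x hx hx0
  set G := μ.real {ω | x < χ ω} with hG
  set G2 := μ.real {ω | 1 / 2 * x < χ ω} with hG2
  have hGe : G = L x / x ^ α := htail x hx0
  have hG2e : G2 = L (1 / 2 * x) / (1 / 2 * x) ^ α := htail _ (by positivity)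
  have hLx := hLpos x hx0
  have hxa : 0 < x ^ α := Real.rpow_pos_of_pos hx0 _
  have hG0 : 0 < G := by rw [hGe]; positivity
  have hGG : (1 + δ) * G ≤ G2 := by
    have e : G2 = (L (1 / 2 * x) / L x * 2 ^ α) * G := by
      rw [hGe, hG2e, Real.mul_rpow (by norm_num) hx0.le, Real.div_rpow (by norm_num) (by norm_num),
        Real.one_rpow]
      field_simp
    rw [e]
    gcongr
  have hI1 := integrable_trunc (μ := μ) hχ h0 x
  have hI2 := integrable_trunc (μ := μ) hχ h0 (2 * x)
  have hm : ∀ z, MeasurableSet {ω | z < χ ω} := fun z => measurableSet_lt measurable_const hχ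
  have hind : ∀ z, Integrable ({ω | z < χ ω}.indicator (1 : Ω → ℝ)) μ := fun z =>
    (integrable_const (1 : ℝ)).indicator (hm z)
  have hup : ∫ ω, (if χ ω ≤ 2 * x then χ ω else 0) ∂μ ≤
      ∫ ω, (if χ ω ≤ x then χ ω else 0) ∂μ + 2 * x * G := by
    rw [hG, ← integral_indicator_one (hm x), ← integral_const_mul,
      ← integral_add hI1 ((hind x).const_mul _)]
    refine integral_mono hI2 (hI1.add ((hind x).const_mul _)) fun ω => ?_
    by_cases hω : x < χ ω
    · rw [Set.indicator_of_mem (by simpa using hω)]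
      simp only [not_le.2 hω, if_false, Pi.one_apply]
      split_ifs <;> linarith
    · rw [Set.indicator_of_notMem (by simpa using hω)]
      simp only [not_lt.1 hω, if_true]
      split_ifs <;> linarith [h0 ω]
  have hlo : x / 2 * (G2 - G) ≤ ∫ ω, (if χ ω ≤ x then χ ω else 0) ∂μ := by
    rw [hG, hG2, ← integral_indicator_one (hm x), ← integral_indicator_one (hm (1 / 2 * x)),
      ← integral_sub (hind _) (hind _), ← integral_const_mul]
    refine integral_mono (((hind _).sub (hind _)).const_mul _) hI1 fun ω => ?_
    by_cases hω : x < χ ω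
    · have hω2 : 1 / 2 * x < χ ω := by linarith
      simp only
      rw [Set.indicator_of_mem (s := {ω | x < χ ω}) (by simpa using hω),
        Set.indicator_of_mem (by simpa using hω2)]
      simp [not_le.2 hω]
    · simp only [not_lt.1 hω, if_true]
      rw [Set.indicator_of_notMem (s := {ω | x < χ ω}) (by simpa using hω)]
      by_cases hω2 : 1 / 2 * x < χ ω
      · rw [Set.indicator_of_mem (by simpa using hω2)]
        simp only [Pi.one_apply]; linarith
      · rw [Set.indicator_of_notMem (by simpa using hω2)]
        simpa using h0 ω
  have hlo2 : x / 2 * (δ * G) ≤ ∫ ω, (if χ ω ≤ x then χ ω else 0) ∂μ := by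
    refine le_trans ?_ hlo
    gcongr
    linarith
  refine ⟨lt_of_lt_of_le (by positivity) hlo2, hup.trans ?_⟩
  have : 2 * x * G = 4 / δ * (x / 2 * (δ * G)) := by field_simp; ring
  rw [this, add_mul, one_mul]
  gcongr

end Helpers

theorem truncated_Phi_one_is_little_o
    {Ω : Type*} [MeasurableSpace Ω] (T : Ω → Ω) (μ : Measure Ω)
    {F : Type*} [NormedRing F] [NormedAlgebra ℝ F] [CompleteSpace F]
    (ι : F →ₐ[ℝ] Ω → ℝ) (χ : Ω → ℝ)
    (hD : PropertyD T μ ι χ)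
    (L : ℝ → ℝ) (hL : SlowlyVarying L) (hLpos : ∀ x : ℝ, 0 < x → 0 < L x)
    {α : ℝ} (hα0 : 0 < α) (hα1 : α < 1)
    (htail : ∀ x : ℝ, 0 < x → (μ {ω | x < χ ω}).toReal = L x / x ^ α)
    (b : ℕ → ℕ) (hb : Tendsto b atTop atTop)
    (hbo : Tendsto (fun n => (b n : ℝ) / (n : ℝ)) atTop (𝓝 0))
    (r : ℕ) (hr1 : 1 ≤ r) (hrψ : psiCoeff μ T χ r < 1)
    (hrmin : ∀ m : ℕ, 1 ≤ m → m < r → 1 ≤ psiCoeff μ T χ m)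
    :
    Tendsto (fun n =>
      (∫ ω, truncSumN T χ n (2 * gSeq μ χ b n) ω ∂μ) *
        (μ {ω | (b n : ℝ) - 2 * r + 1 <
          (((Finset.Icc 1 n).filter fun j =>
            gSeq μ χ b n < χ (T^[j - 1] ω)).card : ℝ)}).toReal /
      ∫ ω, truncSumN T χ n (gSeq μ χ b n) ω ∂μ) atTop (𝓝 0) := by
  haveI := hD.prob
  have hT := hD.invariant
  have hχ := hD.chi_meas
  have h0 := hD.chi_nonneg
  obtain ⟨V, hV0, hV⟩ := var_main hT hχ hD.mixing (Bd_of_psi (μ := μ) hrψ)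
  obtain ⟨C, hC⟩ := ratio_bound (μ := μ) hχ h0 hL hLpos hα0 htail
  have hbR : Tendsto (fun n => (b n : ℝ)) atTop atTop := tendsto_natCast_atTop_atTop.comp hb
  have hs : Tendsto (fun n => (b n : ℝ) ^ ((2 : ℝ) / 3)) atTop atTop :=
    (tendsto_rpow_atTop (by norm_num)).comp hbR
  have hle : ∀ n, 1 ≤ b n → (b n : ℝ) ^ ((2 : ℝ) / 3) ≤ b n := fun n hn => by
    calc (b n : ℝ) ^ ((2 : ℝ) / 3) ≤ (b n : ℝ) ^ (1 : ℝ) :=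
          Real.rpow_le_rpow_of_exponent_le (by exact_mod_cast hn) (by norm_num)
      _ = b n := Real.rpow_one _
  -- the levels satisfy `y_n < 1`, `y_n → 1`
  have hlt : ∀ᶠ n in atTop, (b n : ℝ) ^ ((2 : ℝ) / 3) < b n := by
    filter_upwards [hb.eventually_ge_atTop 2] with n hn
    calc (b n : ℝ) ^ ((2 : ℝ) / 3) < (b n : ℝ) ^ (1 : ℝ) :=
          Real.rpow_lt_rpow_of_exponent_lt (by exact_mod_cast hn) (by norm_num)
      _ = b n := Real.rpow_one _
  have hy : Tendsto (fun n : ℕ => 1 - ((b n : ℝ) - (b n : ℝ) ^ ((2 : ℝ) / 3)) / n) atTop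
      (𝓝 1) := by
    have hz : Tendsto (fun n : ℕ => ((b n : ℝ) - (b n : ℝ) ^ ((2 : ℝ) / 3)) / n) atTop
        (𝓝 0) := by
      refine tendsto_of_tendsto_of_tendsto_of_le_of_le' tendsto_const_nhds hbo ?_ ?_
      · filter_upwards [hlt] with n hn
        exact div_nonneg (by linarith) (by positivity)
      · filter_upwards with n
        have : 0 ≤ (b n : ℝ) ^ ((2 : ℝ) / 3) := by positivity
        gcongr
        linarith
    simpa using hz.const_sub 1
  have hy1 : ∀ᶠ n : ℕ in atTop, 1 - ((b n : ℝ) - (b n : ℝ) ^ ((2 : ℝ) / 3)) / n < 1 := by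
    filter_upwards [hlt, eventually_gt_atTop 0] with n hn hn0
    have hn0' : (0 : ℝ) < n := by exact_mod_cast hn0
    have : 0 < ((b n : ℝ) - (b n : ℝ) ^ ((2 : ℝ) / 3)) / n := div_pos (by linarith) hn0'
    linarith
  have hy0 := hy.eventually (eventually_gt_nhds (show (0 : ℝ) < 1 by norm_num))
  have hg : Tendsto (gSeq μ χ b) atTop atTop := by
    refine tendsto_atTop.2 fun X => ?_
    have hX0 : (0 : ℝ) < max X 1 := lt_of_lt_of_le one_pos (le_max_right _ _)
    have hFX : distF μ χ (max X 1) < 1 := by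
      have h1 := distF_compl (μ := μ) hχ (max X 1)
      have h2 : 0 < μ.real {ω | max X 1 < χ ω} := by
        rw [show μ.real {ω | max X 1 < χ ω} = _ from htail _ hX0]
        exact div_pos (hLpos _ hX0) (Real.rpow_pos_of_pos hX0 _)
      linarith
    filter_upwards [hy0, hy1, hy.eventually (eventually_gt_nhds hFX)] with n h1 h2 h3
    exact (le_max_left _ _).trans ((genInv_facts hχ h1 h2).2 _ h3)
  have hPhi : Tendsto (fun n => μ.real {ω | (b n : ℝ) - 2 * r + 1 <
      (cnt T χ (gSeq μ χ b n) 0 n ω : ℝ)}) atTop (𝓝 0) := by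
    have hbd : Tendsto (fun n => V * 4 * (2 : ℝ) ^ ((5 : ℝ) / 4) *
        (b n : ℝ) ^ (-((1 : ℝ) / 12))) atTop (𝓝 0) := by
      simpa using ((tendsto_rpow_neg_atTop (show (0 : ℝ) < 1 / 12 by norm_num)).comp
        hbR).const_mul (V * 4 * (2 : ℝ) ^ ((5 : ℝ) / 4))
    refine tendsto_of_tendsto_of_tendsto_of_le_of_le' tendsto_const_nhds hbd
      (Eventually.of_forall fun n => measureReal_nonneg) ?_
    filter_upwards [hy0, hy1, hb.eventually_ge_atTop 1, hs.eventually_ge_atTop (4 * (r : ℝ)),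
      eventually_gt_atTop 0] with n h1 h2 h3 h4 h5
    refine cheb_bound hT hχ hV0 hV r (b n) n (gSeq μ χ b n) h3 ?_ h4
    have hn0' : (0 : ℝ) < n := by exact_mod_cast h5
    have h6 := (genInv_facts (μ := μ) hχ h1 h2).1
    have h7 : μ.real {ω | gSeq μ χ b n < χ ω} ≤
        ((b n : ℝ) - (b n : ℝ) ^ ((2 : ℝ) / 3)) / n := by
      rw [distF_compl hχ]
      unfold gSeq
      linarith
    rw [le_div_iff₀ hn0'] at h7
    linarith
  have hC2 : Tendsto (fun n => C * μ.real {ω | (b n : ℝ) - 2 * r + 1 <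
      (cnt T χ (gSeq μ χ b n) 0 n ω : ℝ)}) atTop (𝓝 0) := by
    simpa using hPhi.const_mul C
  have hnn : ∀ x, 0 ≤ ∫ ω, (if χ ω ≤ x then χ ω else 0) ∂μ := fun x =>
    integral_nonneg fun ω => by
      dsimp only
      split_ifs
      · exact h0 ω
      · exact le_rfl
  simp only [integral_truncSumN hT hχ h0, card_eq_cnt]
  refine tendsto_of_tendsto_of_tendsto_of_le_of_le' tendsto_const_nhds hC2 ?_ ?_
  · filter_upwards with n
    have h1 := hnn (2 * gSeq μ χ b n)
    have h2 := hnn (gSeq μ χ b n)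
    positivity
  · filter_upwards [hg.eventually hC, eventually_gt_atTop 0] with n hn hn0
    obtain ⟨hpos, hCn⟩ := hn
    have hn0' : (0 : ℝ) < n := by exact_mod_cast hn0
    rw [div_le_iff₀ (by positivity)]
    have h3 : 0 ≤ μ.real {ω | (b n : ℝ) - 2 * r + 1 < (cnt T χ (gSeq μ χ b n) 0 n ω : ℝ)} :=
      measureReal_nonneg
    have h4 := mul_le_mul_of_nonneg_left (mul_le_mul_of_nonneg_right hCn h3) hn0'.le
    refine le_trans (le_of_eq ?_) (h4.trans (le_of_eq ?_))
    · rw [Measure.real]; ring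
    · ring
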